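/- Every orbit of the Panyushev complement 𝔛 on the lower ideals of [2] × K_{n-1} has size exactly 2n+1, there are exactly n+2 orbits, and each orbit contains exactly one lower ideal of cardinality 2n. -/

import Mathlib

/-- The poset `K_n = [n] ⊕ ([1] ⊔ [1]) ⊕ [n]`. -/
abbrev K (n : ℕ) : Type := Fin n ⊕ₗ ((Fin 1 ⊕ Fin 1) ⊕ₗ Fin n)

instance (n : ℕ) : Fintype (K n) :=
  inferInstanceAs (Fintype (Fin n ⊕ ((Fin 1 ⊕ Fin 1) ⊕ Fin n)))

open Classical in
/-- The Panyushev complement `𝔛`: the lower ideal generated by the minimal elements of the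
complement of `I`. -/
noncomputable def pan {P : Type*} [PartialOrder P] [Fintype P] (I : Finset P) : Finset P :=
  Finset.univ.filter
    (fun y => ∃ x, x ∉ I ∧ (∀ z, z ∉ I → z ≤ x → z = x) ∧ y ≤ x)


structure KL (P : Type*) [PartialOrder P] (m : ℕ) (rk : P → ℕ) (el : Bool → P) : Prop where
  le_iff : ∀ k l : P, k ≤ l ↔ rk k < rk l ∨ k = l
  rk_lt : ∀ k, rk k < 2 * m + 1
  ex : ∀ r, r < 2 * m + 1 → ∃ k, rk k = r
  uniq : ∀ k l, rk k = rk l → rk k ≠ m → k = l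
  rk_el : ∀ b, rk (el b) = m
  mid : ∀ k, rk k = m → ∃ b, k = el b
  el_inj : ∀ b c, el b = el c → b = c

def rkK (m : ℕ) (k : K m) : ℕ :=
  match ofLex k with
  | .inl i => i
  | .inr s => match ofLex s with
    | .inl _ => m
    | .inr j => m + 1 + j

def elK (m : ℕ) (b : Bool) : K m :=
  Sum.inrₗ (Sum.inlₗ (if b then Sum.inl 0 else Sum.inr 0))

theorem KL_K (m : ℕ) : KL (K m) m (rkK m) (elK m) where
  le_iff := by
    rintro (i | (i | j) | i) (i' | (i' | j') | i') <;>
    first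
    | (change toLex (Sum.inl _) ≤ toLex (Sum.inl _) ↔ _
       rw [Sum.Lex.inl_le_inl_iff, le_iff_lt_or_eq]
       refine or_congr Iff.rfl ⟨fun h => by rw [h], fun h => by injection h⟩)
    | (change toLex (Sum.inl _) ≤ toLex (Sum.inr _) ↔ _
       refine iff_of_true (Sum.Lex.inl_le_inr _ _) (Or.inl ?_)
       simp only [rkK, ofLex]
       first | exact i.2 | (have := i.2; change (i:ℕ) < m + 1 + i'; omega))
    | (change toLex (Sum.inr _) ≤ toLex (Sum.inl _) ↔ _
       refine iff_of_false (Sum.Lex.not_inr_le_inl) ?_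
       rintro (h | h)
       · first 
         | (have := i'.2; change m < (i':ℕ) at h; omega)
         | (have := i'.2; change m + 1 + i < (i':ℕ) at h; omega)
       · injection h)
    | (change toLex (Sum.inr (toLex (Sum.inl _))) ≤ toLex (Sum.inr (toLex (Sum.inl _))) ↔ _
       rw [Sum.Lex.inr_le_inr_iff, Sum.Lex.inl_le_inl_iff]
       first
       | (rw [Sum.inl_le_inl_iff]
          exact iff_of_true (le_of_eq (Subsingleton.elim _ _))
            (Or.inr (by rw [Subsingleton.elim i i'])))
       | (rw [Sum.inr_le_inr_iff]
          exact iff_of_true (le_of_eq (Subsingleton.elim _ _))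
            (Or.inr (by rw [Subsingleton.elim j j'])))
       | (refine iff_of_false (by simp) ?_
          rintro (h | h)
          · change m < m at h; omega
          · injection h with h; injection h with h; injection h))
    | (change toLex (Sum.inr (toLex (Sum.inl _))) ≤ toLex (Sum.inr (toLex (Sum.inr _))) ↔ _
       rw [Sum.Lex.inr_le_inr_iff]
       refine iff_of_true (Sum.Lex.inl_le_inr _ _) (Or.inl ?_)
       change m < m + 1 + (i' : ℕ); omega)
    | (change toLex (Sum.inr (toLex (Sum.inr _))) ≤ toLex (Sum.inr (toLex (Sum.inl _))) ↔ _
       rw [Sum.Lex.inr_le_inr_iff]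
       refine iff_of_false (Sum.Lex.not_inr_le_inl) ?_
       rintro (h | h)
       · change m + 1 + (i : ℕ) < m at h; omega
       · injection h with h; injection h)
    | (change toLex (Sum.inr (toLex (Sum.inr _))) ≤ toLex (Sum.inr (toLex (Sum.inr _))) ↔ _
       rw [Sum.Lex.inr_le_inr_iff, Sum.Lex.inr_le_inr_iff, le_iff_lt_or_eq]
       refine or_congr ?_ ⟨fun h => by rw [h], fun h => by injection h with h; injection h⟩
       change (i : ℕ) < i' ↔ m + 1 + (i : ℕ) < m + 1 + i'
       omega)
  rk_lt := by
    rintro (i | (i | j) | i)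
    · change (i:ℕ) < _; omega
    · change m < _; omega
    · change m < _; omega
    · change m + 1 + (i:ℕ) < _; omega
  ex := by
    intro r hr
    rcases lt_trichotomy r m with h | h | h
    · exact ⟨Sum.inlₗ ⟨r, h⟩, rfl⟩
    · exact ⟨elK m true, h.symm⟩
    · refine ⟨Sum.inrₗ (Sum.inrₗ ⟨r - m - 1, by omega⟩), ?_⟩
      change m + 1 + (r - m - 1) = r
      omega
  uniq := by
    rintro (i | (i | j) | i) (i' | (i' | j') | i') h h1 <;>
    first
    | exact absurd rfl h1
    | (change (i : ℕ) = i' at h; rw [Fin.ext h])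
    | (change (i : ℕ) = m at h; omega)
    | (change (i : ℕ) = m + 1 + (i' : ℕ) at h; omega)
    | (change m + 1 + (i : ℕ) = (i' : ℕ) at h; omega)
    | (change m + 1 + (i : ℕ) = m at h; omega)
    | (change m + 1 + (i : ℕ) = m + 1 + (i' : ℕ) at h
       have h2 : (i : ℕ) = i' := by omega
       rw [Fin.ext h2])
  rk_el := by intro b; rfl
  mid := by
    rintro (i | (i | j) | i) h
    · change (i:ℕ) = m at h; omega
    · refine ⟨true, ?_⟩; rw [Subsingleton.elim i 0]; rfl
    · refine ⟨false, ?_⟩; rw [Subsingleton.elim j 0]; rfl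
    · change m + 1 + (i:ℕ) = m at h; omega
  el_inj := by
    intro b c h
    cases b <;> cases c <;> first | rfl | (exfalso; simp [elK] at h)

def genI {P : Type*} [PartialOrder P] (X Y : P → Prop) (k : P) : Prop :=
  ∃ l, ¬ Y l ∧ X l ∧ (∀ z, ¬ Y z → z ≤ l → z = l) ∧ k ≤ l

open Classical in
noncomputable def mkI {P : Type*} [Fintype P] (X Y : P → Prop) : Finset (Fin 2 × P) :=
  Finset.univ.filter (fun p => if p.1 = 0 then X p.2 else Y p.2)

theorem mem_mkI0 {P : Type*} [Fintype P] (X Y : P → Prop) (k : P) :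
    ((0 : Fin 2), k) ∈ mkI X Y ↔ X k := by simp [mkI]

theorem mem_mkI1 {P : Type*} [Fintype P] (X Y : P → Prop) (k : P) :
    ((1 : Fin 2), k) ∈ mkI X Y ↔ Y k := by simp [mkI]

theorem ext_mkI {P : Type*} [Fintype P] (I J : Finset (Fin 2 × P))
    (h0 : ∀ k, ((0 : Fin 2), k) ∈ I ↔ ((0 : Fin 2), k) ∈ J)
    (h1 : ∀ k, ((1 : Fin 2), k) ∈ I ↔ ((1 : Fin 2), k) ∈ J) : I = J := by
  ext ⟨i, k⟩
  fin_cases i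
  · exact h0 k
  · exact h1 k

theorem pan_mkI {P : Type*} [PartialOrder P] [Fintype P] (X Y : P → Prop)
    (hX : ∀ k l, k ≤ l → X l → X k) :
    pan (mkI X Y) =
      mkI (fun k => genI X Y k ∨ genI (fun _ => True) X k) (genI X Y) := by
  have key1 : ∀ l : P, (((1 : Fin 2), l) ∉ mkI X Y ∧
      (∀ z, z ∉ mkI X Y → z ≤ ((1 : Fin 2), l) → z = ((1 : Fin 2), l))) ↔
      (¬ Y l ∧ X l ∧ (∀ z, ¬ Y z → z ≤ l → z = l)) := by
    intro l
    rw [mem_mkI1]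
    refine and_congr Iff.rfl ⟨fun h => ⟨?_, ?_⟩, fun h => ?_⟩
    · by_contra hl
      have := h ((0 : Fin 2), l) (by rwa [mem_mkI0]) ⟨by simp, le_refl _⟩
      simp at this
    · intro z hz hzl
      have := h ((1 : Fin 2), z) (by rwa [mem_mkI1]) ⟨le_refl _, hzl⟩
      simpa using this
    · rintro ⟨i, z⟩ hz ⟨_, hzl⟩
      fin_cases i
      · exact absurd (hX _ _ hzl h.1) (fun h' => hz ((mem_mkI0 X Y z).2 h'))
      · have := h.2 z (fun h' => hz ((mem_mkI1 X Y z).2 h')) hzl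
        rw [this]; rfl
  have key0 : ∀ l : P, (((0 : Fin 2), l) ∉ mkI X Y ∧
      (∀ z, z ∉ mkI X Y → z ≤ ((0 : Fin 2), l) → z = ((0 : Fin 2), l))) ↔
      (¬ X l ∧ (∀ z, ¬ X z → z ≤ l → z = l)) := by
    intro l
    rw [mem_mkI0]
    refine and_congr Iff.rfl ⟨fun h => ?_, fun h => ?_⟩
    · intro z hz hzl
      have := h ((0 : Fin 2), z) (by rwa [mem_mkI0]) ⟨le_refl _, hzl⟩
      simpa using this
    · rintro ⟨i, z⟩ hz ⟨hi, hzl⟩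
      fin_cases i
      · have := h z (fun h' => hz ((mem_mkI0 X Y z).2 h')) hzl
        rw [this]; rfl
      · exact absurd hi (by simp)
  have memp : ∀ y : Fin 2 × P, y ∈ pan (mkI X Y) ↔
      (∃ x, x ∉ mkI X Y ∧ (∀ z, z ∉ mkI X Y → z ≤ x → z = x) ∧ y ≤ x) := by
    intro y; simp [pan]
  apply ext_mkI
  · intro k
    rw [memp, mem_mkI0]
    constructor
    · rintro ⟨⟨i, l⟩, h1, h2, h3⟩
      fin_cases i
      · right
        obtain ⟨a, b⟩ := (key0 l).1 ⟨h1, h2⟩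
        exact ⟨l, a, trivial, b, h3.2⟩
      · left
        obtain ⟨a, b, c⟩ := (key1 l).1 ⟨h1, h2⟩
        exact ⟨l, a, b, c, h3.2⟩
    · rintro (⟨l, a, b, c, h⟩ | ⟨l, a, -, c, h⟩)
      · obtain ⟨h1, h2⟩ := (key1 l).2 ⟨a, b, c⟩
        exact ⟨_, h1, h2, by simp, h⟩
      · obtain ⟨h1, h2⟩ := (key0 l).2 ⟨a, c⟩
        exact ⟨_, h1, h2, by simp, h⟩
  · intro k
    rw [memp, mem_mkI1]
    constructor
    · rintro ⟨⟨i, l⟩, h1, h2, h3⟩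
      fin_cases i
      · exact absurd h3.1 (by simp)
      · obtain ⟨a, b, c⟩ := (key1 l).1 ⟨h1, h2⟩
        exact ⟨l, a, b, c, h3.2⟩
    · rintro ⟨l, a, b, c, h⟩
      obtain ⟨h1, h2⟩ := (key1 l).2 ⟨a, b, c⟩
      exact ⟨_, h1, h2, by simp, h⟩

/-- rank-truncated ideal -/
def CI {P : Type*} (rk : P → ℕ) (x : ℕ) (k : P) : Prop := rk k < x

/-- the two special ideals -/
def AI {P : Type*} (m : ℕ) (rk : P → ℕ) (el : Bool → P) (b : Bool) (k : P) : Prop :=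
  rk k < m ∨ k = el b

namespace KL

variable {P : Type*} [PartialOrder P] {m : ℕ} {rk : P → ℕ} {el : Bool → P}

theorem CI_lower (h : KL P m rk el) (x : ℕ) (k l : P) (hkl : k ≤ l) (hl : CI rk x l) :
    CI rk x k := by
  unfold CI at *
  rcases (h.le_iff k l).1 hkl with h1 | rfl <;> omega

theorem AI_lower (h : KL P m rk el) (b : Bool) (k l : P) (hkl : k ≤ l)
    (hl : AI m rk el b l) : AI m rk el b k := by
  unfold AI at *
  rcases (h.le_iff k l).1 hkl with h1 | rfl
  · rcases hl with hl | rfl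
    · left; omega
    · left; rw [h.rk_el] at h1; exact h1
  · exact hl

theorem mid' (h : KL P m rk el) (b : Bool) (k : P) (hk : rk k = m) : k = el b ∨ k = el !b := by
  obtain ⟨c, rfl⟩ := h.mid k hk
  cases b <;> cases c <;> simp

theorem el_ne (h : KL P m rk el) (b : Bool) : el b ≠ el !b := by
  intro h1
  have := h.el_inj _ _ h1
  cases b <;> simp at this

theorem gen_self (X : P → Prop) : genI X X = CI rk 0 := by
  funext k
  apply propext
  constructor
  · rintro ⟨l, a, b, _⟩; exact absurd b a
  · intro hk; unfold CI at hk; omega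

theorem gen_C (h : KL P m rk el) (X : P → Prop) (y : ℕ) (hy : y ≤ 2 * m)
    (hX : ∀ k, rk k = y → X k) : genI X (CI rk y) = CI rk (y + 1) := by
  funext k
  apply propext
  unfold CI
  constructor
  · rintro ⟨l, a, b, c, d⟩
    obtain ⟨k', hk'⟩ := h.ex y (by omega)
    have hl : rk l = y := by
      by_contra hne
      have := c k' (by omega) ((h.le_iff _ _).2 (Or.inl (by omega)))
      rw [this] at hk'; omega
    rcases (h.le_iff _ _).1 d with h1 | rfl <;> omega
  · intro hk
    have : ∃ l, rk l = y ∧ k ≤ l := by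
      by_cases hky : rk k = y
      · exact ⟨k, hky, le_refl _⟩
      · obtain ⟨k', hk'⟩ := h.ex y (by omega)
        exact ⟨k', hk', (h.le_iff _ _).2 (Or.inl (by omega))⟩
    obtain ⟨l, hl, hkl⟩ := this
    refine ⟨l, by omega, hX _ hl, ?_, hkl⟩
    intro z hz hzl
    rcases (h.le_iff _ _).1 hzl with h1 | h1
    · omega
    · exact h1

theorem gen_top (h : KL P m rk el) (X : P → Prop) : genI X (CI rk (2 * m + 1)) = CI rk 0 := by
  funext k
  apply propext
  constructor
  · rintro ⟨l, a, _⟩; exact absurd (h.rk_lt l) a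
  · intro hk; unfold CI at hk; omega

theorem gen_A (h : KL P m rk el) (X : P → Prop) (b : Bool) (hX : X (el !b)) :
    genI X (AI m rk el b) = AI m rk el !b := by
  funext k
  apply propext
  have hnot : ¬ AI m rk el b (el !b) := by
    rintro (h1 | h1)
    · rw [h.rk_el] at h1; omega
    · exact h.el_ne b h1.symm
  constructor
  · rintro ⟨l, a, _, c, d⟩
    have hl : l = el !b := by
      by_contra hne
      have hlm : ¬ rk l < m := fun h' => a (Or.inl h')
      by_cases hlm' : rk l = m
      · rcases h.mid' b l hlm' with h1 | h1
        · exact a (Or.inr h1)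
        · exact hne h1
      · exact hne (c _ hnot ((h.le_iff _ _).2 (Or.inl (by rw [h.rk_el]; omega)))).symm
    subst hl
    rcases (h.le_iff _ _).1 d with h1 | h1
    · rw [h.rk_el] at h1; exact Or.inl h1
    · exact Or.inr h1
  · intro hk
    refine ⟨el !b, hnot, hX, ?_, ?_⟩
    · intro z hz hzl
      rcases (h.le_iff _ _).1 hzl with h1 | h1
      · rw [h.rk_el] at h1; exact absurd (Or.inl h1) hz
      · exact h1
    · rw [h.le_iff, h.rk_el]; exact hk

theorem gen_AC (h : KL P m rk el) (b : Bool) :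
    genI (AI m rk el b) (CI rk m) = AI m rk el b := by
  funext k
  apply propext
  constructor
  · rintro ⟨l, a, hb, c, d⟩
    exact h.AI_lower b k l d hb
  · intro hk
    refine ⟨el b, ?_, Or.inr rfl, ?_, ?_⟩
    · unfold CI; rw [h.rk_el]; omega
    · intro z hz hzl
      unfold CI at hz
      rcases (h.le_iff _ _).1 hzl with h1 | h1
      · rw [h.rk_el] at h1; omega
      · exact h1
    · rw [h.le_iff, h.rk_el]; exact hk

variable [Fintype P]

theorem mkI_congr {X Y X' Y' : P → Prop} (h1 : ∀ k, X k ↔ X' k) (h2 : ∀ k, Y k ↔ Y' k) :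
    mkI X Y = mkI X' Y' := by
  rw [funext fun k => propext (h1 k), funext fun k => propext (h2 k)]

theorem step1 (h : KL P m rk el) (x y : ℕ) (hx : x ≤ 2 * m) (hy : y < x) :
    pan (mkI (CI rk x) (CI rk y)) = mkI (CI rk (x + 1)) (CI rk (y + 1)) := by
  rw [pan_mkI _ _ (h.CI_lower x),
    h.gen_C _ y (by omega) (fun k hk => by unfold CI; omega),
    h.gen_C _ x hx (fun k hk => trivial)]
  exact mkI_congr (fun k => by unfold CI; omega) (fun k => Iff.rfl)

theorem step2 (h : KL P m rk el) (x : ℕ) (hx : x ≤ 2 * m) :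
    pan (mkI (CI rk x) (CI rk x)) = mkI (CI rk (x + 1)) (CI rk 0) := by
  rw [pan_mkI _ _ (h.CI_lower x), gen_self (rk := rk),
    h.gen_C _ x hx (fun k hk => trivial)]
  exact mkI_congr (fun k => by unfold CI; omega) (fun k => Iff.rfl)

theorem step3 (h : KL P m rk el) (y : ℕ) (hy : y ≤ 2 * m) :
    pan (mkI (CI rk (2 * m + 1)) (CI rk y)) = mkI (CI rk (y + 1)) (CI rk (y + 1)) := by
  rw [pan_mkI _ _ (h.CI_lower _),
    h.gen_C (CI rk (2 * m + 1)) y hy (fun k hk => h.rk_lt k), h.gen_top]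
  exact mkI_congr (fun k => by unfold CI; omega) (fun k => Iff.rfl)

theorem step4 (h : KL P m rk el) :
    pan (mkI (CI rk (2 * m + 1)) (CI rk (2 * m + 1))) = mkI (CI rk 0) (CI rk 0) := by
  rw [pan_mkI _ _ (h.CI_lower _), h.gen_top, h.gen_top]
  exact mkI_congr (fun k => by unfold CI; omega) (fun k => Iff.rfl)

theorem step5 (h : KL P m rk el) (b : Bool) :
    pan (mkI (AI m rk el b) (AI m rk el b)) = mkI (AI m rk el !b) (CI rk 0) := by
  rw [pan_mkI _ _ (h.AI_lower _), gen_self (rk := rk), h.gen_A _ b trivial]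
  exact mkI_congr (fun k => by unfold CI; simp) (fun k => Iff.rfl)

theorem step6 (h : KL P m rk el) (b : Bool) (y : ℕ) (hy : y < m) :
    pan (mkI (AI m rk el b) (CI rk y)) = mkI (AI m rk el !b) (CI rk (y + 1)) := by
  rw [pan_mkI _ _ (h.AI_lower _), h.gen_A _ b trivial,
    h.gen_C (AI m rk el b) y (by omega) (fun k hk => Or.inl (by omega))]
  exact mkI_congr (fun k => or_iff_right_of_imp
    fun hk => Or.inl (by unfold CI at hk; omega)) (fun k => Iff.rfl)

theorem step7 (h : KL P m rk el) (b : Bool) :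
    pan (mkI (AI m rk el b) (CI rk m)) = mkI (CI rk (m + 1)) (AI m rk el b) := by
  rw [pan_mkI _ _ (h.AI_lower _), h.gen_A _ b trivial, h.gen_AC]
  refine mkI_congr (fun k => ⟨?_, ?_⟩) (fun k => Iff.rfl)
  · rintro ((h1 | rfl) | (h1 | rfl)) <;> unfold CI <;> first | omega | (rw [h.rk_el]; omega)
  · intro hk
    unfold CI at hk
    by_cases h1 : rk k < m
    · exact Or.inl (Or.inl h1)
    · rcases h.mid' b k (by omega) with h2 | h2
      · exact Or.inl (Or.inr h2)
      · exact Or.inr (Or.inr h2)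

theorem AI_le_CI (h : KL P m rk el) (b : Bool) (x : ℕ) (hx : m < x) (k : P)
    (hk : AI m rk el b k) : CI rk x k := by
  unfold CI
  rcases hk with h1 | rfl
  · omega
  · rw [h.rk_el]; exact hx

theorem step8 (h : KL P m rk el) (b : Bool) (x : ℕ) (hx : m < x) (hx2 : x ≤ 2 * m) :
    pan (mkI (CI rk x) (AI m rk el b)) = mkI (CI rk (x + 1)) (AI m rk el !b) := by
  rw [pan_mkI _ _ (h.CI_lower _),
    h.gen_A _ b (by unfold CI; rw [h.rk_el]; exact hx), h.gen_C _ x hx2 (fun _ _ => trivial)]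
  exact mkI_congr (fun k => or_iff_right_of_imp (h.AI_le_CI _ _ (by omega) k)) (fun k => Iff.rfl)

theorem step9 (h : KL P m rk el) (b : Bool) :
    pan (mkI (CI rk (2 * m + 1)) (AI m rk el b)) = mkI (AI m rk el !b) (AI m rk el !b) := by
  rw [pan_mkI _ _ (h.CI_lower _),
    h.gen_A (CI rk (2 * m + 1)) b (h.rk_lt _), h.gen_top]
  exact mkI_congr (fun k => by unfold CI; simp) (fun k => Iff.rfl)

end KL

/-- Abstract orbit lemma. -/
theorem orbit_card {α : Type*} (f : α → α) (Q : α → Prop) (N : ℕ) (hN : 0 < N) (I : α)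
    (hp : f^[N] I = I) (hu : ∃! k, k < N ∧ Q (f^[k] I)) :
    Nat.card {J : α // ∃ k : ℕ, f^[k] I = J} = N ∧
      ∃! J : α, (∃ k : ℕ, f^[k] I = J) ∧ Q J := by
  have hmod : ∀ k, f^[k % N] I = f^[k] I := fun k =>
    Function.IsPeriodicPt.iterate_mod_apply (f := f) (n := N) hp k
  obtain ⟨k0, ⟨hk0, hQ0⟩, huk⟩ := hu
  have huniq : ∀ k, Q (f^[k] I) → k % N = k0 := fun k hk =>
    huk _ ⟨Nat.mod_lt _ hN, by rw [hmod]; exact hk⟩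
  have hinj : ∀ i j, i < N → j < N → f^[i] I = f^[j] I → i = j := by
    intro i j hi hj hij
    -- shift both so that the first lands at k0
    have h1 : f^[(k0 + (N - i)) + i] I = f^[(k0 + (N - i)) + j] I := by
      rw [Function.iterate_add_apply, hij, ← Function.iterate_add_apply]
    have h2 : (k0 + (N - i)) + i = k0 + N := by omega
    have h3 : f^[k0 + N] I = f^[k0] I := by rw [Function.iterate_add_apply, hp]
    rw [h2, h3] at h1
    have h4 := huniq ((k0 + (N - i)) + j) (h1 ▸ hQ0)
    have h5 : (k0 + (N - i) + j) ≡ k0 + (N - i) + i [MOD N] := by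
      rw [h2]; unfold Nat.ModEq; rw [h4, Nat.add_mod_right, Nat.mod_eq_of_lt hk0]
    have h6 := Nat.ModEq.add_left_cancel' _ h5
    exact (Nat.ModEq.eq_of_lt_of_lt h6 hj hi).symm
  constructor
  · have e : Fin N ≃ {J : α // ∃ k : ℕ, f^[k] I = J} := by
      refine Equiv.ofBijective (fun i => ⟨f^[i] I, i, rfl⟩) ⟨?_, ?_⟩
      · intro i j hij
        exact Fin.ext (hinj i j i.2 j.2 (congrArg Subtype.val hij))
      · rintro ⟨J, k, rfl⟩
        exact ⟨⟨k % N, Nat.mod_lt _ hN⟩, Subtype.ext (hmod k)⟩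
    rw [← Nat.card_congr e, Nat.card_eq_fintype_card, Fintype.card_fin]
  · refine ⟨f^[k0] I, ⟨⟨k0, rfl⟩, hQ0⟩, ?_⟩
    rintro J ⟨⟨k, rfl⟩, hk⟩
    rw [← huniq k hk, hmod]

theorem orbits_count {α : Type*} (f : α → α) (S Q : α → Prop) (N : ℕ) (hN : 0 < N)
    (hS : ∀ I, S I → S (f I))
    (hp : ∀ I, S I → f^[N] I = I) (hu : ∀ I, S I → ∃! k, k < N ∧ Q (f^[k] I)) :
    Nat.card {T : Set α // ∃ I, S I ∧ T = {J | ∃ k : ℕ, f^[k] I = J}} =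
      Nat.card {J : α // S J ∧ Q J} := by
  have hSk : ∀ k I, S I → S (f^[k] I) := by
    intro k
    induction k with
    | zero => intro I h; exact h
    | succ k ih => intro I h; rw [Function.iterate_succ_apply]; exact ih _ (hS _ h)
  have hmod : ∀ I, S I → ∀ k, f^[k % N] I = f^[k] I := fun I hI k =>
    Function.IsPeriodicPt.iterate_mod_apply (f := f) (n := N) (hp I hI) k
  symm
  refine Nat.card_congr (Equiv.ofBijective
    (fun J => ⟨{L | ∃ k : ℕ, f^[k] J.1 = L}, J.1, J.2.1, rfl⟩) ⟨?_, ?_⟩)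
  · rintro ⟨J, hJ, hQ⟩ ⟨J', hJ', hQ'⟩ h
    have h1 : {L | ∃ k : ℕ, f^[k] J = L} = {L | ∃ k : ℕ, f^[k] J' = L} := congrArg Subtype.val h
    have h2 : J ∈ {L | ∃ k : ℕ, f^[k] J' = L} := by rw [← h1]; exact ⟨0, rfl⟩
    exact Subtype.ext ((orbit_card f Q N hN J' (hp J' hJ') (hu J' hJ')).2.unique
      ⟨h2, hQ⟩ ⟨⟨0, rfl⟩, hQ'⟩)
  · rintro ⟨T, I, hI, rfl⟩
    obtain ⟨k0, ⟨hk0, hQ0⟩, -⟩ := hu I hI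
    refine ⟨⟨f^[k0] I, hSk _ _ hI, hQ0⟩, Subtype.ext ?_⟩
    ext L
    constructor
    · rintro ⟨k, hk⟩
      exact ⟨k + k0, by rw [Function.iterate_add_apply]; exact hk⟩
    · rintro ⟨k, hk⟩
      refine ⟨k + (N - k0), ?_⟩
      change f^[k + (N - k0)] (f^[k0] I) = L
      rw [← Function.iterate_add_apply]
      have : k + (N - k0) + k0 = k + N := by omega
      rw [this, Function.iterate_add_apply, hp I hI, hk]

theorem succ_mod_aux (N p : ℕ) (hN : 0 < N) :
    (p + 1) % N = if p % N + 1 = N then 0 else p % N + 1 := by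
  have h := Nat.mod_lt p hN
  rw [← Nat.mod_add_mod]
  split_ifs with h1
  · rw [h1, Nat.mod_self]
  · exact Nat.mod_eq_of_lt (by omega)

theorem card_mkI {P : Type*} [Fintype P] (X Y : P → Prop) :
    (mkI X Y).card = Nat.card {k // X k} + Nat.card {k // Y k} := by
  classical
  have : mkI X Y = (Finset.univ.filter X).image (fun k => ((0 : Fin 2), k)) ∪
      (Finset.univ.filter Y).image (fun k => ((1 : Fin 2), k)) := by
    apply ext_mkI
    · intro k; rw [mem_mkI0]; simp
    · intro k; rw [mem_mkI1]; simp
  rw [this, Finset.card_union_of_disjoint, Finset.card_image_of_injective,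
    Finset.card_image_of_injective, Nat.card_eq_fintype_card, Nat.card_eq_fintype_card,
    Fintype.card_subtype, Fintype.card_subtype]
  · intro a b h; simpa using h
  · intro a b h; simpa using h
  · rw [Finset.disjoint_left]
    rintro ⟨i, k⟩ h1 h2
    simp only [Finset.mem_image, Prod.mk.injEq] at h1 h2
    obtain ⟨_, _, h3, _⟩ := h1
    obtain ⟨_, _, h4, _⟩ := h2
    rw [← h3] at h4
    simp at h4

noncomputable def phi0 {P : Type*} [Fintype P] (m : ℕ) (rk : P → ℕ) (a b : ℕ) :
    Finset (Fin 2 × P) :=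
  if max a b = 2 * m + 2 then mkI (CI rk (min a b)) (CI rk (min a b))
  else mkI (CI rk (max a b)) (CI rk (min a b))

noncomputable def phi {P : Type*} [Fintype P] (m : ℕ) (rk : P → ℕ) (p q : ℕ) :
    Finset (Fin 2 × P) :=
  phi0 m rk (p % (2 * m + 3)) (q % (2 * m + 3))

noncomputable def psi {P : Type*} [Fintype P] (m : ℕ) (rk : P → ℕ) (el : Bool → P)
    (e : Bool) (t : ℕ) : Finset (Fin 2 × P) :=
  if t % (2 * m + 3) = 0 then mkI (AI m rk el e) (AI m rk el e)
  else if t % (2 * m + 3) ≤ m + 1 then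
    mkI (AI m rk el (xor e (t % (2 * m + 3)).bodd)) (CI rk (t % (2 * m + 3) - 1))
  else
    mkI (CI rk (t % (2 * m + 3) - 1)) (AI m rk el (xor e (t % (2 * m + 3) - 1).bodd))

theorem phi0_comm {P : Type*} [Fintype P] (m : ℕ) (rk : P → ℕ) (a b : ℕ) :
    phi0 m rk a b = phi0 m rk b a := by
  unfold phi0; rw [max_comm, min_comm]

namespace KL

variable {P : Type*} [PartialOrder P] {m : ℕ} {rk : P → ℕ} {el : Bool → P} [Fintype P]

theorem phi0_step (h : KL P m rk el) (a b : ℕ) (hab : a < b) (hb : b < 2 * m + 3) :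
    pan (phi0 m rk a b) = phi0 m rk (if a + 1 = 2 * m + 3 then 0 else a + 1)
      (if b + 1 = 2 * m + 3 then 0 else b + 1) := by
  rw [if_neg (by omega : ¬ a + 1 = 2 * m + 3)]
  unfold phi0
  rw [max_eq_right hab.le, min_eq_left hab.le]
  by_cases h1 : b = 2 * m + 2
  · rw [if_pos h1, if_pos (by omega : b + 1 = 2 * m + 3), max_eq_left (Nat.zero_le _),
      min_eq_right (Nat.zero_le _)]
    by_cases h2 : a = 2 * m + 1
    · rw [if_pos (by omega), h2, h.step4]
    · rw [if_neg (by omega), h.step2 a (by omega)]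
  · rw [if_neg h1, if_neg (by omega : ¬ b + 1 = 2 * m + 3), max_eq_right (by omega),
      min_eq_left (by omega)]
    by_cases h2 : b = 2 * m + 1
    · rw [if_pos (by omega), h2, h.step3 a (by omega)]
    · rw [if_neg (by omega), h.step1 b a (by omega) hab]

theorem phi_step (h : KL P m rk el) (p q : ℕ) (hpq : p % (2 * m + 3) ≠ q % (2 * m + 3)) :
    pan (phi m rk p q) = phi m rk (p + 1) (q + 1) := by
  unfold phi
  rw [succ_mod_aux _ p (by omega), succ_mod_aux _ q (by omega)]
  have h1 := Nat.mod_lt p (by omega : 2 * m + 3 > 0)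
  have h2 := Nat.mod_lt q (by omega : 2 * m + 3 > 0)
  rcases lt_or_gt_of_ne hpq with h3 | h3
  · exact h.phi0_step _ _ h3 h2
  · rw [phi0_comm, phi0_comm _ _ (ite _ _ _)]
    exact h.phi0_step _ _ h3 h1

theorem psi_step (h : KL P m rk el) (e : Bool) (t : ℕ) :
    pan (psi m rk el e t) = psi m rk el e (t + 1) := by
  unfold psi
  rw [succ_mod_aux _ t (by omega)]
  have h1 := Nat.mod_lt t (by omega : 2 * m + 3 > 0)
  generalize t % (2 * m + 3) = r at *
  by_cases hr0 : r = 0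
  · subst hr0
    rw [if_pos rfl, if_neg (by omega : ¬ 0 + 1 = 2 * m + 3), if_neg (by omega),
      if_pos (by omega), h.step5]
    simp
  rw [if_neg hr0]
  obtain ⟨s, rfl⟩ : ∃ s, r = s + 1 := ⟨r - 1, by omega⟩
  by_cases hr1 : s + 1 ≤ m + 1
  · rw [if_pos hr1, if_neg (by omega : ¬ s + 1 + 1 = 2 * m + 3), if_neg (by omega)]
    by_cases hr2 : s = m
    · subst hr2
      rw [if_neg (by omega)]
      simp only [Nat.add_sub_cancel]
      exact h.step7 _
    · rw [if_pos (by omega)]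
      simp only [Nat.add_sub_cancel]
      rw [h.step6 _ s (by omega), Nat.bodd_succ (s + 1), Bool.xor_not]
  · rw [if_neg hr1]
    simp only [Nat.add_sub_cancel]
    by_cases hr2 : s = 2 * m + 1
    · subst hr2
      rw [if_pos (by omega : 2 * m + 1 + 1 + 1 = 2 * m + 3), if_pos rfl, h.step9]
      simp
    · rw [if_neg (by omega : ¬ s + 1 + 1 = 2 * m + 3), if_neg (by omega), if_neg (by omega),
        h.step8 _ s (by omega) (by omega), Nat.add_sub_cancel, Nat.bodd_succ s, Bool.xor_not]

theorem phi_iter (h : KL P m rk el) (k p q : ℕ) (hpq : p % (2 * m + 3) ≠ q % (2 * m + 3)) :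
    pan^[k] (phi m rk p q) = phi m rk (p + k) (q + k) := by
  induction k with
  | zero => rfl
  | succ k ih =>
    rw [Function.iterate_succ_apply', ih, h.phi_step]
    · rfl
    · intro h1
      exact hpq (Nat.ModEq.add_right_cancel' k h1)

theorem psi_iter (h : KL P m rk el) (k : ℕ) (e : Bool) (t : ℕ) :
    pan^[k] (psi m rk el e t) = psi m rk el e (t + k) := by
  induction k with
  | zero => rfl
  | succ k ih => rw [Function.iterate_succ_apply', ih, h.psi_step]; rfl

theorem card_C (h : KL P m rk el) (x : ℕ) (hx : x ≤ 2 * m + 1) :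
    Nat.card {k // CI rk x k} = if x ≤ m then x else x + 1 := by
  classical
  rw [Nat.card_eq_fintype_card, Fintype.card_subtype]
  induction x with
  | zero => simp [CI]
  | succ x ih =>
    have ih := ih (by omega)
    have hdis : Disjoint (Finset.univ.filter (CI rk x)) (Finset.univ.filter (fun k => rk k = x)) := by
      rw [Finset.disjoint_left]
      intro k h1 h2
      simp [CI] at h1 h2
      omega
    have hun : Finset.univ.filter (CI rk (x + 1)) =
        Finset.univ.filter (CI rk x) ∪ Finset.univ.filter (fun k => rk k = x) := by
      ext k
      simp [CI]
      omega
    rw [hun, Finset.card_union_of_disjoint hdis, ih]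
    by_cases hxm : x = m
    · have : Finset.univ.filter (fun k => rk k = x) = {el true, el !true} := by
        ext k
        simp only [Finset.mem_filter, Finset.mem_univ, true_and, Finset.mem_insert,
          Finset.mem_singleton]
        constructor
        · intro hk; exact h.mid' true k (by omega)
        · rintro (rfl | rfl) <;> rw [h.rk_el, hxm]
      rw [this, Finset.card_pair (h.el_ne true), if_pos (by omega), if_neg (by omega)]
    · obtain ⟨k0, hk0⟩ := h.ex x (by omega)
      have : Finset.univ.filter (fun k => rk k = x) = {k0} := by
        ext k
        simp only [Finset.mem_filter, Finset.mem_univ, true_and, Finset.mem_singleton]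
        constructor
        · intro hk; exact h.uniq k k0 (by omega) (by omega)
        · rintro rfl; exact hk0
      rw [this, Finset.card_singleton]
      split_ifs <;> omega

theorem card_A (h : KL P m rk el) (b : Bool) : Nat.card {k // AI m rk el b k} = m + 1 := by
  classical
  have h1 := h.card_C m (by omega)
  rw [if_pos le_rfl, Nat.card_eq_fintype_card, Fintype.card_subtype] at h1
  rw [Nat.card_eq_fintype_card, Fintype.card_subtype]
  have : Finset.univ.filter (AI m rk el b) = insert (el b) (Finset.univ.filter (CI rk m)) := by
    ext k
    simp [AI, CI]
    tauto
  rw [this, Finset.card_insert_of_notMem, h1]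
  simp [CI, h.rk_el]

theorem phi_card (h : KL P m rk el) (p q : ℕ) (hpq : p % (2 * m + 3) ≠ q % (2 * m + 3)) :
    (phi m rk p q).card = 2 * (m + 1) ↔ (2 * m + 3) ∣ p + q + 2 := by
  have h1 := Nat.mod_lt p (by omega : 2 * m + 3 > 0)
  have h2 := Nat.mod_lt q (by omega : 2 * m + 3 > 0)
  have h3 : (2 * m + 3) ∣ p + q + 2 ↔
      (2 * m + 3) ∣ p % (2 * m + 3) + q % (2 * m + 3) + 2 := by
    rw [Nat.dvd_iff_mod_eq_zero, Nat.dvd_iff_mod_eq_zero]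
    have : (p + q + 2) ≡ p % (2 * m + 3) + q % (2 * m + 3) + 2 [MOD (2 * m + 3)] :=
      ((Nat.mod_modEq p _).symm.add (Nat.mod_modEq q _).symm).add_right 2
    rw [this]
  rw [h3]
  unfold phi
  generalize p % (2 * m + 3) = a at *
  generalize q % (2 * m + 3) = b at *
  clear h3
  have main : ∀ a b : ℕ, a < b → b < 2 * m + 3 →
      ((phi0 m rk a b).card = 2 * (m + 1) ↔ (2 * m + 3) ∣ a + b + 2) := by
    intro a b hab hb
    have hd : (2 * m + 3) ∣ a + b + 2 ↔ a + b + 2 = 2 * m + 3 := by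
      constructor
      · rintro ⟨c, hc⟩
        have hc2 : c < 2 := by
          by_contra hcc
          have h5 : (2 * m + 3) * 3 ≤ (2 * m + 3) * c ∨ c = 2 := by
            by_cases h6 : c = 2
            · exact Or.inr h6
            · exact Or.inl (Nat.mul_le_mul_left _ (by omega))
          rcases h5 with h5 | rfl <;> omega
        interval_cases c <;> omega
      · intro h5; rw [h5]
    rw [hd]
    unfold phi0
    rw [max_eq_right hab.le, min_eq_left hab.le]
    split_ifs with h4
    · rw [card_mkI, h.card_C _ (by omega)]
      split_ifs <;> omega
    · rw [card_mkI, h.card_C _ (by omega), h.card_C _ (by omega)]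
      split_ifs <;> omega
  rcases lt_or_gt_of_ne hpq with h3 | h3
  · exact main a b h3 h2
  · rw [phi0_comm, add_comm a b]
    exact main b a h3 h1

theorem psi_card (h : KL P m rk el) (e : Bool) (t : ℕ) :
    (psi m rk el e t).card = 2 * (m + 1) ↔ (2 * m + 3) ∣ t := by
  rw [Nat.dvd_iff_mod_eq_zero]
  unfold psi
  have h1 := Nat.mod_lt t (by omega : 2 * m + 3 > 0)
  generalize t % (2 * m + 3) = r at *
  split_ifs with h2 h3
  · rw [card_mkI, h.card_A]; omega
  · rw [card_mkI, h.card_A, h.card_C _ (by omega)]; split_ifs <;> omega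
  · rw [card_mkI, h.card_A, h.card_C _ (by omega)]; split_ifs <;> omega

theorem lower_class (h : KL P m rk el) (X : P → Prop) (hX : ∀ k l, k ≤ l → X l → X k) :
    (∃ x, x ≤ 2 * m + 1 ∧ X = CI rk x) ∨ ∃ b, X = AI m rk el b := by
  classical
  by_cases hb : ∃ b, X (el b) ∧ ¬ X (el !b)
  · obtain ⟨b, h1, h2⟩ := hb
    refine Or.inr ⟨b, funext fun k => propext ⟨fun hk => ?_, ?_⟩⟩
    · by_contra hne
      unfold AI at hne
      push Not at hne
      by_cases hkm : rk k = m
      · rcases h.mid' b k hkm with h3 | rfl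
        · exact hne.2 h3
        · exact h2 hk
      · exact h2 (hX _ k ((h.le_iff _ _).2 (Or.inl (by rw [h.rk_el]; omega))) hk)
    · rintro (h3 | rfl)
      · exact hX _ _ ((h.le_iff _ _).2 (Or.inl (by rw [h.rk_el]; exact h3))) h1
      · exact h1
  · push Not at hb
    left
    by_cases hall : ∀ k, X k
    · exact ⟨2 * m + 1, le_rfl, funext fun k => propext (iff_of_true (hall k) (h.rk_lt k))⟩
    · have hex : ∃ r, ∃ l, rk l = r ∧ ¬ X l := by
        push Not at hall
        obtain ⟨l, hl⟩ := hall
        exact ⟨_, l, rfl, hl⟩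
      obtain ⟨l, hl, hXl⟩ := Nat.find_spec hex
      have hmin := fun r (hr : r < Nat.find hex) => Nat.find_min hex hr
      generalize Nat.find hex = x at *
      have hxl := h.rk_lt l
      refine ⟨x, by omega, funext fun k => propext ⟨fun hk => ?_, fun hk => ?_⟩⟩
      · unfold CI
        by_contra hkx
        by_cases hke : rk k = x
        · by_cases hxm : x = m
          · obtain ⟨b, rfl⟩ := h.mid k (by omega)
            rcases h.mid' b l (by omega) with rfl | rfl
            · exact hXl hk
            · exact hXl (hb b hk)
          · rw [h.uniq k l (by omega) (by omega)] at hk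
            exact hXl hk
        · exact hXl (hX l k ((h.le_iff _ _).2 (Or.inl (by omega))) hk)
      · by_contra hXk
        exact hmin _ hk ⟨k, rfl, hXk⟩

theorem class_mk (h : KL P m rk el) (X Y : P → Prop)
    (hX : ∀ k l, k ≤ l → X l → X k) (hY : ∀ k l, k ≤ l → Y l → Y k) (hYX : ∀ k, Y k → X k) :
    (∃ p q, p < q ∧ q < 2 * m + 3 ∧ mkI X Y = phi m rk p q) ∨
      ∃ e t, t < 2 * m + 3 ∧ mkI X Y = psi m rk el e t := by
  rcases h.lower_class X hX with ⟨x, hx, rfl⟩ | ⟨b, rfl⟩ <;>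
  rcases h.lower_class Y hY with ⟨y, hy, rfl⟩ | ⟨c, rfl⟩
  · left
    have hyx : y ≤ x := by
      by_contra hlt
      obtain ⟨k, hk⟩ := h.ex x (by omega)
      have := hYX k (by unfold CI; omega)
      unfold CI at this; omega
    rcases Nat.lt_or_ge y x with h1 | h1
    · refine ⟨y, x, h1, by omega, ?_⟩
      unfold phi phi0
      rw [Nat.mod_eq_of_lt (by omega : y < 2 * m + 3), Nat.mod_eq_of_lt (by omega : x < 2 * m + 3),
        max_eq_right h1.le, min_eq_left h1.le, if_neg (by omega)]
    · have h2 : y = x := by omega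
      subst h2
      refine ⟨y, 2 * m + 2, by omega, by omega, ?_⟩
      unfold phi phi0
      rw [Nat.mod_eq_of_lt (by omega : y < 2 * m + 3),
        Nat.mod_eq_of_lt (by omega : 2 * m + 2 < 2 * m + 3),
        max_eq_right (by omega), min_eq_left (by omega), if_pos rfl]
  · right
    have hmx : m < x := by
      have := hYX (el c) (Or.inr rfl)
      unfold CI at this
      rwa [h.rk_el] at this
    refine ⟨xor c x.bodd, x + 1, by omega, ?_⟩
    unfold psi
    rw [Nat.mod_eq_of_lt (by omega), if_neg (by omega), if_neg (by omega), Nat.add_sub_cancel,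
      Bool.xor_assoc, Bool.xor_self, Bool.xor_false]
  · right
    have hmy : y ≤ m := by
      by_contra hlt
      have h1 := hYX (el !b) (by unfold CI; rw [h.rk_el]; omega)
      rcases h1 with h1 | h1
      · rw [h.rk_el] at h1; omega
      · exact h.el_ne b h1.symm
    refine ⟨xor b (y + 1).bodd, y + 1, by omega, ?_⟩
    unfold psi
    rw [Nat.mod_eq_of_lt (by omega), if_neg (by omega), if_pos (by omega), Nat.add_sub_cancel,
      Bool.xor_assoc, Bool.xor_self, Bool.xor_false]
  · right
    have hbc : c = b := by
      rcases hYX (el c) (Or.inr rfl) with h1 | h1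
      · rw [h.rk_el] at h1; omega
      · exact h.el_inj _ _ h1
    subst hbc
    refine ⟨c, 0, by omega, ?_⟩
    unfold psi
    rw [if_pos (Nat.zero_mod _)]

theorem class_all (h : KL P m rk el) (I : Finset (Fin 2 × P))
    (hI : IsLowerSet (I : Set (Fin 2 × P))) :
    (∃ p q, p < q ∧ q < 2 * m + 3 ∧ I = phi m rk p q) ∨
      ∃ e t, t < 2 * m + 3 ∧ I = psi m rk el e t := by
  have hmk : I = mkI (fun k => ((0 : Fin 2), k) ∈ I) (fun k => ((1 : Fin 2), k) ∈ I) := by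
    apply ext_mkI
    · intro k; rw [mem_mkI0]
    · intro k; rw [mem_mkI1]
  have := h.class_mk (fun k => ((0 : Fin 2), k) ∈ I) (fun k => ((1 : Fin 2), k) ∈ I)
    (fun k l hkl hl => hI (show ((0 : Fin 2), k) ≤ ((0 : Fin 2), l) from ⟨le_rfl, hkl⟩) hl)
    (fun k l hkl hl => hI (show ((1 : Fin 2), k) ≤ ((1 : Fin 2), l) from ⟨le_rfl, hkl⟩) hl)
    (fun k hk => hI (show ((0 : Fin 2), k) ≤ ((1 : Fin 2), k) from ⟨by simp, le_rfl⟩) hk)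
  rwa [← hmk] at this

theorem period (h : KL P m rk el) (I : Finset (Fin 2 × P))
    (hI : IsLowerSet (I : Set (Fin 2 × P))) : pan^[2 * m + 3] I = I := by
  rcases h.class_all I hI with ⟨p, q, hpq, hq, rfl⟩ | ⟨e, t, ht, rfl⟩
  · rw [h.phi_iter]
    · unfold phi; rw [Nat.add_mod_right, Nat.add_mod_right]
    · rw [Nat.mod_eq_of_lt hq, Nat.mod_eq_of_lt (by omega)]; omega
  · rw [h.psi_iter]
    unfold psi; rw [Nat.add_mod_right]

theorem unique_k (h : KL P m rk el) (I : Finset (Fin 2 × P))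
    (hI : IsLowerSet (I : Set (Fin 2 × P))) :
    ∃! k, k < 2 * m + 3 ∧ (pan^[k] I).card = 2 * (m + 1) := by
  rcases h.class_all I hI with ⟨p, q, hpq, hq, rfl⟩ | ⟨e, t, ht, rfl⟩
  · have hne : p % (2 * m + 3) ≠ q % (2 * m + 3) := by
      rw [Nat.mod_eq_of_lt hq, Nat.mod_eq_of_lt (by omega)]; omega
    have hiff : ∀ k, (pan^[k] (phi m rk p q)).card = 2 * (m + 1) ↔
        (2 * m + 3) ∣ (p + q + 2) + 2 * k := by
      intro k
      rw [h.phi_iter _ _ _ hne, h.phi_card]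
      · have : p + k + (q + k) + 2 = (p + q + 2) + 2 * k := by ring
        rw [this]
      · intro h1
        exact hne (Nat.ModEq.add_right_cancel' k h1)
    simp only [hiff]
    refine ⟨((p + q + 2) * (m + 1)) % (2 * m + 3), ⟨Nat.mod_lt _ (by omega), ?_⟩, ?_⟩
    · have h1 : (p + q + 2) + 2 * (((p + q + 2) * (m + 1)) % (2 * m + 3)) ≡
          (p + q + 2) + 2 * ((p + q + 2) * (m + 1)) [MOD (2 * m + 3)] :=
        ((Nat.mod_modEq _ _).mul_left 2).add_left _
      refine (h1.dvd_iff (dvd_refl _)).2 ⟨p + q + 2, by ring⟩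
    · rintro k ⟨hk, hd⟩
      have h0 : (2 * m + 3) ∣ (p + q + 2) + 2 * (((p + q + 2) * (m + 1)) % (2 * m + 3)) := by
        have h1 : (p + q + 2) + 2 * (((p + q + 2) * (m + 1)) % (2 * m + 3)) ≡
            (p + q + 2) + 2 * ((p + q + 2) * (m + 1)) [MOD (2 * m + 3)] :=
          ((Nat.mod_modEq _ _).mul_left 2).add_left _
        exact (h1.dvd_iff (dvd_refl _)).2 ⟨p + q + 2, by ring⟩
      have hlt := Nat.mod_lt ((p + q + 2) * (m + 1)) (by omega : 2 * m + 3 > 0)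
      generalize ((p + q + 2) * (m + 1)) % (2 * m + 3) = k' at *
      have h2 : (p + q + 2) + 2 * k ≡ (p + q + 2) + 2 * k' [MOD (2 * m + 3)] :=
        ((Nat.modEq_zero_iff_dvd).2 hd).trans ((Nat.modEq_zero_iff_dvd).2 h0).symm
      have h3 := Nat.ModEq.add_left_cancel' _ h2
      have hcop : Nat.gcd (2 * m + 3) 2 = 1 := by
        have : Nat.Coprime (2 * m + 3) 2 := by
          rw [Nat.coprime_two_right]; exact ⟨m + 1, by ring⟩
        exact this
      exact (Nat.ModEq.cancel_left_of_coprime hcop h3).eq_of_lt_of_lt hk hlt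
  · simp only [h.psi_iter, h.psi_card]
    by_cases h0 : t = 0
    · subst h0
      refine ⟨0, ⟨by omega, by simp⟩, ?_⟩
      rintro k ⟨hk, hd⟩
      rw [zero_add] at hd
      exact Nat.eq_zero_of_dvd_of_lt hd hk
    · refine ⟨2 * m + 3 - t, ⟨by omega, ⟨1, by omega⟩⟩, ?_⟩
      rintro k ⟨hk, ⟨c, hc⟩⟩
      have : c < 2 := by
        by_contra h1
        have := Nat.mul_le_mul_left (2 * m + 3) (by omega : 2 ≤ c)
        omega
      interval_cases c <;> omega

theorem pan_lower {Q : Type*} [PartialOrder Q] [Fintype Q] (I : Finset Q) :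
    IsLowerSet (pan I : Set Q) := by
  intro a b hba ha
  simp only [pan, Finset.coe_filter, Finset.mem_univ, true_and, Set.mem_ofPred_eq] at *
  obtain ⟨x, h1, h2, h3⟩ := ha
  exact ⟨x, h1, h2, hba.trans h3⟩

theorem mkI_lower (X Y : P → Prop)
    (hX : ∀ k l, k ≤ l → X l → X k) (hY : ∀ k l, k ≤ l → Y l → Y k) (hYX : ∀ k, Y k → X k) :
    IsLowerSet (mkI X Y : Set (Fin 2 × P)) := by
  rintro ⟨i, k⟩ ⟨j, l⟩ ⟨hij, hkl⟩ ha
  rw [Finset.mem_coe] at *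
  fin_cases i <;> fin_cases j
  · exact (mem_mkI0 _ _ _).2 (hX _ _ hkl ((mem_mkI0 _ _ _).1 ha))
  · exact absurd hij (by simp)
  · exact (mem_mkI0 _ _ _).2 (hX _ _ hkl (hYX _ ((mem_mkI1 _ _ _).1 ha)))
  · exact (mem_mkI1 _ _ _).2 (hY _ _ hkl ((mem_mkI1 _ _ _).1 ha))

theorem mkI_inj {X Y X' Y' : P → Prop} (h : mkI X Y = mkI X' Y') : Y = Y' := by
  funext k
  apply propext
  rw [← mem_mkI1 X Y, h, mem_mkI1]

/-- representatives -/
noncomputable def rep (m : ℕ) (rk : P → ℕ) (el : Bool → P) :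
    Fin (m + 1) ⊕ Bool → Finset (Fin 2 × P)
  | .inl i => mkI (CI rk (2 * m + 1 - i)) (CI rk i)
  | .inr b => mkI (AI m rk el b) (AI m rk el b)

theorem count (h : KL P m rk el) :
    Nat.card {J : Finset (Fin 2 × P) // IsLowerSet (J : Set (Fin 2 × P)) ∧
      J.card = 2 * (m + 1)} = m + 3 := by
  have hrep : ∀ s, IsLowerSet (rep m rk el s : Set (Fin 2 × P)) ∧
      (rep m rk el s).card = 2 * (m + 1) := by
    rintro (i | b)
    · have hi := i.2
      refine ⟨mkI_lower _ _ (h.CI_lower _) (h.CI_lower _) (fun k hk => ?_), ?_⟩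
      · unfold CI at *; omega
      · unfold rep
        rw [card_mkI, h.card_C _ (by omega), h.card_C _ (by omega)]
        split_ifs <;> omega
    · refine ⟨mkI_lower _ _ (h.AI_lower _) (h.AI_lower _) (fun k hk => hk), ?_⟩
      unfold rep
      rw [card_mkI, h.card_A]
      omega
  have e : Fin (m + 1) ⊕ Bool ≃ {J : Finset (Fin 2 × P) // IsLowerSet (J : Set (Fin 2 × P)) ∧
      J.card = 2 * (m + 1)} := by
    refine Equiv.ofBijective (fun s => ⟨rep m rk el s, hrep s⟩) ⟨?_, ?_⟩
    · intro s t hst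
      have hst : rep m rk el s = rep m rk el t := congrArg Subtype.val hst
      rcases s with i | b <;> rcases t with j | c
      · have h1 : CI rk i = CI rk j := mkI_inj hst
        have h2 := h.card_C i (by omega)
        rw [h1, h.card_C j (by omega), if_pos (by omega), if_pos (by omega)] at h2
        rw [Fin.ext h2]
      · have h1 : CI rk i = AI m rk el c := mkI_inj hst
        have h2 := h.card_C i (by omega)
        rw [h1, h.card_A, if_pos (by omega)] at h2
        omega
      · have h1 : AI m rk el b = CI rk j := mkI_inj hst
        have h2 := h.card_C j (by omega)
        rw [← h1, h.card_A, if_pos (by omega)] at h2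
        omega
      · have h1 : AI m rk el b = AI m rk el c := mkI_inj hst
        have h2 : AI m rk el c (el b) := by rw [← h1]; exact Or.inr rfl
        rcases h2 with h2 | h2
        · rw [h.rk_el] at h2; omega
        · rw [h.el_inj _ _ h2]
    · rintro ⟨J, hJ, hc⟩
      rcases h.class_all J hJ with ⟨p, q, hpq, hq, rfl⟩ | ⟨e, t, ht, rfl⟩
      · have hmp := Nat.mod_eq_of_lt (by omega : p < 2 * m + 3)
        have hmq := Nat.mod_eq_of_lt hq
        rw [h.phi_card p q (by omega)] at hc
        obtain ⟨c, hc⟩ := hc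
        have : c < 2 := by
          by_contra h1
          have := Nat.mul_le_mul_left (2 * m + 3) (by omega : 2 ≤ c)
          omega
        have hs : p + q = 2 * m + 1 := by interval_cases c <;> omega
        refine ⟨.inl ⟨p, by omega⟩, Subtype.ext ?_⟩
        change mkI (CI rk (2 * m + 1 - p)) (CI rk p) = phi m rk p q
        unfold phi phi0
        rw [hmp, hmq, max_eq_right hpq.le, min_eq_left hpq.le, if_neg (by omega)]
        have : 2 * m + 1 - p = q := by omega
        rw [this]
      · rw [h.psi_card] at hc
        have ht0 := Nat.eq_zero_of_dvd_of_lt hc ht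
        subst ht0
        refine ⟨.inr e, Subtype.ext ?_⟩
        change mkI (AI m rk el e) (AI m rk el e) = psi m rk el e 0
        unfold psi
        rw [if_pos (Nat.zero_mod _)]
  rw [← Nat.card_congr e]
  simp

end KL

/-- For `n ≥ 1`, every `𝔛`-orbit on lower ideals of `[2] × K_{n-1}` has size `2n+1` and
contains a unique lower ideal of cardinality `2n`; and there are exactly `n+2` orbits.
(This is the extra-special `Δ(1)` of type `D_{n+2}`.) -/
theorem panyushev_orbits_D (n : ℕ) (hn : 1 ≤ n) :
    (∀ I : Finset (Fin 2 × K (n - 1)),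
      IsLowerSet (I : Set (Fin 2 × K (n - 1))) →
        Nat.card {J : Finset (Fin 2 × K (n - 1)) // ∃ k : ℕ, pan^[k] I = J} =
            2 * n + 1 ∧
          ∃! J : Finset (Fin 2 × K (n - 1)),
            (∃ k : ℕ, pan^[k] I = J) ∧ J.card = 2 * n) ∧
      Nat.card {S : Set (Finset (Fin 2 × K (n - 1))) //
          ∃ I : Finset (Fin 2 × K (n - 1)),
            IsLowerSet (I : Set (Fin 2 × K (n - 1))) ∧
              S = {J | ∃ k : ℕ, pan^[k] I = J}} = n + 2 := by
  obtain ⟨m, rfl⟩ : ∃ m, n = m + 1 := ⟨n - 1, by omega⟩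
  have h : KL (K (m + 1 - 1)) m (rkK m) (elK m) := KL_K m
  have hN : 2 * (m + 1) + 1 = 2 * m + 3 := by ring
  refine ⟨fun I hI => ?_, ?_⟩
  · rw [hN]
    exact orbit_card pan (fun J => J.card = 2 * (m + 1)) (2 * m + 3) (by omega) I
      (h.period I hI) (h.unique_k I hI)
  · have h1 := orbits_count (pan (P := Fin 2 × K (m + 1 - 1))) (fun J => IsLowerSet (J : Set (Fin 2 × K (m + 1 - 1))))
      (fun J => J.card = 2 * (m + 1)) (2 * m + 3) (by omega)
      (fun I _ => KL.pan_lower I) h.period h.unique_k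
    rw [h1]
    exact h.count
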